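/- arXiv:2411.15347 — 2 statements merged into one kernel-verified Lean document; each statement's English description precedes it below -/
import Mathlib

section
/- Let k be a field, let r_1,…,r_n ∈ k be pairwise distinct, let e_1,…,e_n be positive integers, let N = e_1+⋯+e_n, and let f = ∏_{i=1}^n (X−r_i)^{e_i} ∈ k[X]. Then the duplicant of f satisfies 𝔇(f) = (det Σ(f))² = ∏_{1≤i<j≤n} (r_i−r_j)^{2·e_i·e_j}. -/
open Polynomial

namespace Duplicant

variable {k : Type*} [Field k]

/-- Coefficient matrix of a family of polynomials. -/
noncomputable def cm {N : ℕ} (p : Fin N → k[X]) : Matrix (Fin N) (Fin N) k :=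
  Matrix.of fun i j => (p i).coeff j.1

lemma cm_perm {N : ℕ} (p : Fin N → k[X]) (σ : Equiv.Perm (Fin N)) :
    (cm (fun i => p (σ i))).det ^ 2 = (cm p).det ^ 2 := by
  have h : cm (fun i => p (σ i)) = (cm p).submatrix σ id := rfl
  rw [h, Matrix.det_permute, mul_pow]
  rcases Int.units_eq_one_or (Equiv.Perm.sign σ) with h | h <;> simp [h]

lemma cm_mul {m n : ℕ} (f g : k[X]) (hf : f.natDegree ≤ m) (hg : g.natDegree ≤ n)
    (p : Fin m → k[X]) (q : Fin n → k[X])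
    (hp : ∀ a, (p a).degree < m) (hq : ∀ b, (q b).degree < n) :
    (cm (fun i : Fin (m + n) => Fin.addCases (fun a => g * p a) (fun b => f * q b) i)).det
      = resultant f g m n * ((cm p).det * (cm q).det) := by
  have key : ∀ (M d : ℕ) (h w : k[X]) (i : ℕ), h.natDegree ≤ d → w.degree < M →
      (h * w).coeff i = ∑ j : Fin M,
        (if i ∈ Set.Icc (j : ℕ) (j + d) then h.coeff (i - j) else 0) * w.coeff j := by
    intro M d h w i hh hw
    have hw' : w = ∑ j : Fin M, C (w.coeff j) * X ^ (j : ℕ) := by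
      rw [Fin.sum_univ_eq_sum_range (fun j => C (w.coeff j) * X ^ j) M]
      ext t
      simp only [finsetSum_coeff, coeff_C_mul, coeff_X_pow, mul_ite, mul_one, mul_zero,
        Finset.sum_ite_eq, Finset.mem_range]
      split_ifs with ht
      · rfl
      · exact (degree_lt_iff_coeff_zero _ _).1 hw t (by lia)
    conv_lhs => rw [hw']
    rw [Finset.mul_sum, finsetSum_coeff]
    refine Finset.sum_congr rfl fun j _ => ?_
    rw [mul_left_comm, coeff_C_mul, coeff_mul_X_pow', mul_comm]
    congr 1
    simp only [Set.mem_Icc, ite_and]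
    split_ifs with h₁ h₂ <;> try rfl
    exact coeff_eq_zero_of_natDegree_lt (by lia)
  have hmat : (cm (fun i : Fin (m + n) =>
      Fin.addCases (fun a => g * p a) (fun b => f * q b) i)).transpose =
      sylvester f g m n * Matrix.reindex finSumFinEquiv finSumFinEquiv
        (Matrix.fromBlocks (cm p).transpose 0 0 (cm q).transpose) := by
    ext i j
    rw [Matrix.mul_apply, ← finSumFinEquiv.sum_comp, Fintype.sum_sum_type]
    induction j using Fin.addCases with
    | left j =>
      simp [sylvester, cm, key m n g (p j) i hg (hp j)]
    | right j =>
      simp [sylvester, cm, key n m f (q j) i hf (hq j)]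
  rw [← Matrix.det_transpose, hmat, Matrix.det_mul, Matrix.det_reindex_self,
    Matrix.det_fromBlocks_zero₂₁, Matrix.det_transpose, Matrix.det_transpose, resultant]

lemma cm_pow (m : ℕ) (r : k) :
    (cm (fun a : Fin m => (X - C r) ^ (m - (a.1 + 1)))).det ^ 2 = 1 := by
  have h := cm_perm (fun a : Fin m => (X - C r) ^ (a : ℕ)) Fin.revPerm
  simp only [Fin.revPerm_apply, Fin.val_rev] at h
  rw [h]
  have h2 := Matrix.det_matrixOfPolynomials (fun a : Fin m => (X - C r) ^ (a : ℕ))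
    (fun i => by simp) (fun i => (monic_X_sub_C r).pow _)
  rw [← Matrix.det_transpose]
  have h3 : (cm (fun a : Fin m => (X - C r) ^ (a : ℕ))).transpose =
    Matrix.of fun i j : Fin m => ((X - C r) ^ (j : ℕ)).coeff i := rfl
  rw [h3, h2, one_pow]

/-- The row polynomial `f / (X - r_ℓ)^(j+1)`. -/
noncomputable def row {n : ℕ} (r : Fin n → k) (e : Fin n → ℕ)
    (x : (ℓ : Fin n) × Fin (e ℓ)) : k[X] :=
  (X - C (r x.1)) ^ (e x.1 - (x.2.1 + 1)) * ∏ m ∈ Finset.univ.erase x.1, (X - C (r m)) ^ (e m)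

lemma row_zero {n : ℕ} (r : Fin (n + 1) → k) (e : Fin (n + 1) → ℕ) (a : Fin (e 0)) :
    row r e ⟨0, a⟩ = (∏ m : Fin n, (X - C (r m.succ)) ^ (e m.succ)) *
      (X - C (r 0)) ^ (e 0 - (a.1 + 1)) := by
  have : (Finset.univ.erase (0 : Fin (n + 1))) = Finset.univ.map (Fin.succEmb n) := by
    ext x; refine Fin.cases ?_ (fun i => ?_) x <;> simp
  simp [row, this, mul_comm]

lemma row_succ {n : ℕ} (r : Fin (n + 1) → k) (e : Fin (n + 1) → ℕ) (l : Fin n)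
    (a : Fin (e l.succ)) :
    row r e ⟨l.succ, a⟩ = (X - C (r 0)) ^ (e 0) *
      row (fun i => r i.succ) (fun i => e i.succ) ⟨l, a⟩ := by
  have : (Finset.univ.erase l.succ) =
      insert 0 ((Finset.univ.erase l).map (Fin.succEmb n)) := by
    ext x; refine Fin.cases ?_ (fun i => ?_) x <;> simp [eq_comm]
  simp only [row, this]
  rw [Finset.prod_insert (by simp), Finset.prod_map]
  simp only [Fin.coe_succEmb]
  ring

lemma row_degree {n : ℕ} (r : Fin n → k) (e : Fin n → ℕ)
    (x : (ℓ : Fin n) × Fin (e ℓ)) : (row r e x).degree < (∑ i, e i : ℕ) := by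
  obtain ⟨l, a⟩ := x
  have hm : ∀ m ∈ Finset.univ.erase l, ((X - C (r m)) ^ (e m)).Monic :=
    fun m _ => (monic_X_sub_C _).pow _
  have hM : (row r e ⟨l, a⟩).Monic :=
    ((monic_X_sub_C _).pow _).mul (monic_prod_of_monic _ _ hm)
  rw [← natDegree_lt_iff_degree_lt hM.ne_zero, row,
    ((monic_X_sub_C _).pow _).natDegree_mul (monic_prod_of_monic _ _ hm),
    natDegree_prod_of_monic _ _ hm]
  simp only [natDegree_pow, natDegree_X_sub_C, mul_one]
  rw [← Finset.add_sum_erase _ _ (Finset.mem_univ l)]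
  have := a.2
  lia

/-- splitting off the first block -/
def split {n : ℕ} (e : Fin (n + 1) → ℕ) :
    (Fin (e 0) ⊕ ((l : Fin n) × Fin (e l.succ))) ≃ ((l : Fin (n + 1)) × Fin (e l)) where
  toFun := Sum.elim (fun a => ⟨0, a⟩) (fun x => ⟨x.1.succ, x.2⟩)
  invFun x := Fin.cases (motive := fun l => Fin (e l) → _)
    (fun a => Sum.inl a) (fun l a => Sum.inr ⟨l, a⟩) x.1 x.2
  left_inv := by rintro (a | ⟨l, a⟩) <;> rfl
  right_inv := by
    rintro ⟨l, a⟩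
    induction l using Fin.cases <;> rfl

lemma main (n : ℕ) : ∀ (r : Fin n → k) (e : Fin n → ℕ) (N : ℕ)
    (σ : Fin N ≃ ((ℓ : Fin n) × Fin (e ℓ))),
    (cm (fun i => row r e (σ i))).det ^ 2 =
      ∏ i : Fin n, ∏ j ∈ Finset.Ioi i, (r i - r j) ^ (2 * e i * e j) := by
  induction n with
  | zero =>
    intro r e N σ
    have : IsEmpty (Fin N) := ⟨fun i => (σ i).1.elim0⟩
    simp [Matrix.det_isEmpty]
  | succ n ih =>
    intro r e N σ
    have hN : N = e 0 + ∑ i : Fin n, e i.succ := by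
      have := Fintype.card_congr σ
      simpa [Fin.sum_univ_succ] using this
    subst hN
    let ρ : Fin (∑ i : Fin n, e i.succ) ≃ ((l : Fin n) × Fin (e l.succ)) :=
      finSigmaFinEquiv.symm
    let τ : Fin (e 0 + ∑ i : Fin n, e i.succ) ≃ ((l : Fin (n + 1)) × Fin (e l)) :=
      finSumFinEquiv.symm.trans ((Equiv.sumCongr (Equiv.refl _) ρ).trans (split e))
    have h1 := cm_perm (fun i => row r e (τ i)) (σ.trans τ.symm)
    simp only [Equiv.trans_apply, Equiv.apply_symm_apply] at h1
    rw [h1]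
    have h2 : (fun i => row r e (τ i)) = fun i => Fin.addCases
        (fun a : Fin (e 0) => (∏ m : Fin n, (X - C (r m.succ)) ^ (e m.succ)) *
          (X - C (r 0)) ^ (e 0 - (a.1 + 1)))
        (fun b => (X - C (r 0)) ^ (e 0) *
          row (fun i => r i.succ) (fun i => e i.succ) (ρ b)) i := by
      funext i
      induction i using Fin.addCases with
      | left a => simp [τ, split, row_zero]
      | right b => simp [τ, split, row_succ]
    have hg : (∏ m : Fin n, (X - C (r m.succ)) ^ (e m.succ)).natDegree
        ≤ ∑ i : Fin n, e i.succ := by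
      rw [natDegree_prod_of_monic _ _ (fun m _ => (monic_X_sub_C _).pow _)]
      simp
    rw [h2, cm_mul _ _ (by simp) hg _ _ ?_ (fun b => row_degree _ _ _), mul_pow, mul_pow,
      cm_pow, ih, resultant_X_sub_C_pow_left _ _ _ _ hg, Fin.prod_univ_succ]
    · simp only [Fin.Ioi_zero_eq_map, Fin.Ioi_succ, Finset.prod_map, one_mul, eval_prod, eval_pow,
        eval_sub, eval_X, eval_C, Fin.coe_succEmb]
      congr 1
      rw [← Finset.prod_pow, ← Finset.prod_pow]
      refine Finset.prod_congr rfl fun i _ => ?_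
      ring
    · intro a
      rw [degree_pow, degree_X_sub_C]
      have := a.2
      simp only [nsmul_eq_mul, mul_one]
      exact_mod_cast (by lia : e 0 - (a.1 + 1) < e 0)

end Duplicant

/-- **Duplicant formula.** For `f = ∏ (X - rᵢ)^{eᵢ}` with pairwise distinct roots,
the square of the determinant of the coefficient matrix `Σ(f)` (rows indexed by pairs
`(ℓ, j)` with `1 ≤ j ≤ e_ℓ`, whose entries are the coefficients of `f/(X - r_ℓ)^j`)
equals `∏_{i<j} (rᵢ - rⱼ)^{2 eᵢ eⱼ}`. -/
theorem duplicant_eq_prod_sq (k : Type*) [Field k] (n : ℕ) (r : Fin n → k)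
    (hr : Function.Injective r) (e : Fin n → ℕ) (he : ∀ i, 0 < e i)
    (N : ℕ) (hN : N = ∑ i, e i)
    (σ : ((ℓ : Fin n) × Fin (e ℓ)) ≃ Fin N)
    (M : Matrix (Fin N) (Fin N) k)
    (hM : ∀ (ℓ : Fin n) (j : Fin (e ℓ)) (i : Fin N),
      M (σ ⟨ℓ, j⟩) i =
        ((X - C (r ℓ)) ^ (e ℓ - (j.1 + 1)) *
          ∏ m ∈ Finset.univ.erase ℓ, (X - C (r m)) ^ (e m)).coeff i.1) :
    M.det ^ 2 = ∏ i : Fin n, ∏ j ∈ Finset.Ioi i, (r i - r j) ^ (2 * e i * e j) := by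
  rw [← Duplicant.main n r e N σ.symm]
  congr 2
  ext i j
  obtain ⟨⟨l, a⟩, rfl⟩ := σ.surjective i
  rw [hM]
  simp only [Duplicant.cm, Matrix.of_apply, Equiv.symm_apply_apply]
  rfl
end

section
/- Let k be a field, let r_1,…,r_n ∈ k be pairwise distinct, let e_1,…,e_n be positive integers, let N = e_1+⋯+e_n, and let f = ∏_{i=1}^n (X−r_i)^{e_i} ∈ k[X]. Then there exists ε ∈ {1,−1} such that det Σ(f) = ε·∏_{1≤i<j≤n} (r_i−r_j)^{e_i·e_j}. -/
open Polynomial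

namespace SigmaAux

lemma det_pm {k : Type*} [Field k] {α β γ δ : Type*} [Fintype γ] [DecidableEq γ]
    [Fintype δ] [DecidableEq δ] (A : Matrix α β k) (f : γ ≃ α) (g : γ ≃ β)
    (f' : δ ≃ α) (g' : δ ≃ β) :
    (A.submatrix f g).det = (A.submatrix f' g').det ∨
      (A.submatrix f g).det = -(A.submatrix f' g').det := by
  have h : A.submatrix f g =
      ((A.submatrix f' g').submatrix
        (((g.trans g'.symm).symm.trans (f.trans f'.symm) : Equiv.Perm δ)) id).submatrix
        (g.trans g'.symm) (g.trans g'.symm) := by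
    ext x y
    simp
  rw [h, Matrix.det_submatrix_equiv_self, Matrix.det_permute]
  rcases Int.units_eq_one_or
    (Equiv.Perm.sign ((g.trans g'.symm).symm.trans (f.trans f'.symm))) with h | h <;>
  rw [h] <;> simp

lemma coeff_mul_eq {k : Type*} [Field k] (H p : k[X]) (m n i : ℕ) (hH : H.natDegree ≤ n)
    (hp : p.natDegree < m) :
    (H * p).coeff i = ∑ j : Fin m, p.coeff j *
      (if i ∈ Set.Icc (j : ℕ) (j + n) then H.coeff (i - j) else 0) := by
  conv_lhs => rw [p.as_sum_range' m hp, ← Fin.sum_univ_eq_sum_range (fun i => monomial i (p.coeff i)),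
    Finset.mul_sum, finset_sum_coeff]
  refine Finset.sum_congr rfl fun j _ => ?_
  rw [← C_mul_X_pow_eq_monomial, mul_left_comm, coeff_C_mul, coeff_mul_X_pow']
  congr 1
  by_cases h1 : (j : ℕ) ≤ i
  · by_cases h2 : i ≤ j + n
    · simp [h1, h2]
    · simp only [h1, h2, Set.mem_Icc, and_false, if_true, if_false]
      exact coeff_eq_zero_of_natDegree_lt (by omega)
  · simp [h1]

lemma det_sum {k : Type*} [Field k] {ι κ : Type*} [Fintype ι] [DecidableEq ι]
    [Fintype κ] [DecidableEq κ] (m n : ℕ) (p : ι → k[X]) (q : κ → k[X])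
    (s : ι ≃ Fin m) (t : κ ≃ Fin n) (hp : ∀ a, (p a).natDegree < m)
    (hq : ∀ a, (q a).natDegree < n) (G H : k[X]) (hG : G.natDegree ≤ m)
    (hH : H.natDegree ≤ n) (u : ι ⊕ κ ≃ Fin (m + n)) :
    ∃ ε : k, (ε = 1 ∨ ε = -1) ∧
    (Matrix.of fun x y : ι ⊕ κ =>
      ((Sum.elim (fun a => H * p a) (fun b => G * q b) x : k[X])).coeff (u y)).det =
     ε * ((Matrix.of fun a b : ι => (p a).coeff (s b)).det *
      (Matrix.of fun a b : κ => (q a).coeff (t b)).det * resultant G H m n) := by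
  set w : ι ⊕ κ ≃ Fin (m + n) := (Equiv.sumCongr s t).trans finSumFinEquiv with hw
  set B : Matrix (ι ⊕ κ) (Fin (m + n)) k := Matrix.of fun x i =>
      ((Sum.elim (fun a => H * p a) (fun b => G * q b) x : k[X])).coeff i with hB
  have key : B.submatrix (Equiv.refl _) w =
      Matrix.fromBlocks (Matrix.of fun a b : ι => (p a).coeff (s b)) 0 0
        (Matrix.of fun a b : κ => (q a).coeff (t b)) *
      ((sylvester G H m n).transpose.submatrix w w) := by
    ext x y
    rw [Matrix.mul_apply, Fintype.sum_sum_type]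
    rcases x with a | b
    · simp only [hB, Matrix.submatrix_apply, Equiv.refl_apply, Matrix.of_apply, Sum.elim_inl,
        Matrix.fromBlocks_apply₁₁, Matrix.fromBlocks_apply₁₂, Matrix.zero_apply, zero_mul,
        Finset.sum_const_zero, add_zero, Matrix.transpose_apply, sylvester]
      rw [coeff_mul_eq H (p a) m n _ hH (hp a), ← Equiv.sum_comp s]
      refine Finset.sum_congr rfl fun j _ => ?_
      have : w (Sum.inl j) = Fin.castAdd n (s j) := by simp [hw]
      rw [this, Fin.addCases_left]
    · simp only [hB, Matrix.submatrix_apply, Equiv.refl_apply, Matrix.of_apply, Sum.elim_inr,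
        Matrix.fromBlocks_apply₂₁, Matrix.fromBlocks_apply₂₂, Matrix.zero_apply, zero_mul,
        Finset.sum_const_zero, zero_add, Matrix.transpose_apply, sylvester]
      rw [coeff_mul_eq G (q b) n m _ hG (hq b), ← Equiv.sum_comp t]
      refine Finset.sum_congr rfl fun j _ => ?_
      have : w (Sum.inr j) = Fin.natAdd m (t j) := by simp [hw]
      rw [this, Fin.addCases_right]
  have hdet : (B.submatrix (Equiv.refl _) w).det =
      (Matrix.of fun a b : ι => (p a).coeff (s b)).det *
      (Matrix.of fun a b : κ => (q a).coeff (t b)).det * resultant G H m n := by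
    rw [key, Matrix.det_mul, Matrix.det_fromBlocks_zero₂₁, Matrix.det_submatrix_equiv_self,
      Matrix.det_transpose, resultant]
  rw [← hdet]
  change ∃ ε : k, (ε = 1 ∨ ε = -1) ∧ (B.submatrix (Equiv.refl _) u).det = _
  rcases det_pm B (Equiv.refl _) u (Equiv.refl _) w with h | h
  · exact ⟨1, Or.inl rfl, by rw [h, one_mul]⟩
  · exact ⟨-1, Or.inr rfl, by rw [h, neg_one_mul]⟩

lemma det_pow {k : Type*} [Field k] (r : k) (m : ℕ) :
    (Matrix.of fun a b : Fin m => ((X - C r) ^ (m - (a.1 + 1))).coeff (Fin.revPerm b : Fin m)).det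
      = 1 := by
  have := Matrix.det_matrixOfPolynomials (fun i : Fin m => (X - C r) ^ (i : ℕ))
    (fun i => by simp) (fun i => (monic_X_sub_C r).pow _)
  rw [← Matrix.det_transpose, ← Matrix.det_submatrix_equiv_self Fin.revPerm] at this
  rw [← this]
  congr 1

/-- the row polynomial -/
noncomputable def P {k : Type*} [Field k] {n : ℕ} (r : Fin n → k) (e : Fin n → ℕ)
    (x : (ℓ : Fin n) × Fin (e ℓ)) : k[X] :=
  (X - C (r x.1)) ^ (e x.1 - (x.2.1 + 1)) *
    ∏ m ∈ Finset.univ.erase x.1, (X - C (r m)) ^ (e m)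

lemma natDegree_prod_pow {k : Type*} [Field k] {n : ℕ} (r : Fin n → k) (e : Fin n → ℕ)
    (s : Finset (Fin n)) : (∏ m ∈ s, (X - C (r m)) ^ (e m)).natDegree = ∑ m ∈ s, e m := by
  rw [natDegree_prod_of_monic _ _ (fun i _ => (monic_X_sub_C _).pow _)]
  simp

lemma natDegree_P {k : Type*} [Field k] {n : ℕ} (r : Fin n → k) (e : Fin n → ℕ)
    (x : (ℓ : Fin n) × Fin (e ℓ)) : (P r e x).natDegree < ∑ i, e i := by
  rw [P, Monic.natDegree_mul ((monic_X_sub_C _).pow _)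
    (monic_prod_of_monic _ _ fun i _ => (monic_X_sub_C _).pow _), natDegree_prod_pow,
    ← Finset.add_sum_erase _ e (Finset.mem_univ x.1)]
  have := x.2.2
  simp
  omega

/-- splitting the index type -/
def split {n : ℕ} (e : Fin (n + 1) → ℕ) :
    Fin (e 0) ⊕ ((ℓ : Fin n) × Fin (e ℓ.succ)) ≃ ((ℓ : Fin (n + 1)) × Fin (e ℓ)) where
  toFun := Sum.elim (fun a => ⟨0, a⟩) (fun x => ⟨x.1.succ, x.2⟩)
  invFun x := Fin.cases (motive := fun ℓ => Fin (e ℓ) → _) (fun a => Sum.inl a)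
    (fun ℓ a => Sum.inr ⟨ℓ, a⟩) x.1 x.2
  left_inv := by rintro (a | ⟨ℓ, a⟩) <;> rfl
  right_inv := by
    rintro ⟨ℓ, a⟩
    induction ℓ using Fin.cases <;> rfl

lemma P_zero {k : Type*} [Field k] {n : ℕ} (r : Fin (n + 1) → k) (e : Fin (n + 1) → ℕ)
    (a : Fin (e 0)) : P r e ⟨0, a⟩ =
      (∏ m : Fin n, (X - C (r m.succ)) ^ (e m.succ)) * (X - C (r 0)) ^ (e 0 - (a.1 + 1)) := by
  have : (Finset.univ.erase (0 : Fin (n + 1))) = Finset.univ.map (Fin.succEmb n) := by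
    ext x
    induction x using Fin.cases <;> simp
  simp only [P]
  rw [this, Finset.prod_map, mul_comm]
  rfl

lemma P_succ {k : Type*} [Field k] {n : ℕ} (r : Fin (n + 1) → k) (e : Fin (n + 1) → ℕ)
    (ℓ : Fin n) (a : Fin (e ℓ.succ)) : P r e ⟨ℓ.succ, a⟩ =
      (X - C (r 0)) ^ (e 0) * P (fun i => r i.succ) (fun i => e i.succ) ⟨ℓ, a⟩ := by
  have : (Finset.univ.erase ℓ.succ) =
      Finset.cons 0 ((Finset.univ.erase ℓ).map (Fin.succEmb n)) (by simp) := by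
    ext x
    induction x using Fin.cases <;> simp [(Fin.succ_ne_zero _).symm]
  simp only [P]
  rw [this, Finset.prod_cons, Finset.prod_map, mul_left_comm]
  rfl

lemma main (k : Type*) [Field k] (n : ℕ) : ∀ (r : Fin n → k) (e : Fin n → ℕ)
    (N : ℕ) (_ : N = ∑ i, e i) (σ : ((ℓ : Fin n) × Fin (e ℓ)) ≃ Fin N),
    ∃ ε : k, (ε = 1 ∨ ε = -1) ∧
      (Matrix.of fun x y => (P r e x).coeff (σ y)).det =
        ε * ∏ i : Fin n, ∏ j ∈ Finset.Ioi i, (r i - r j) ^ (e i * e j) := by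
  induction n with
  | zero =>
    intro r e N hN σ
    exact ⟨1, Or.inl rfl, by simp⟩
  | succ n ih =>
    intro r e N hN σ
    rw [Fin.sum_univ_succ] at hN
    subst hN
    let t : ((ℓ : Fin n) × Fin (e ℓ.succ)) ≃ Fin (∑ i : Fin n, e i.succ) := finSigmaFinEquiv
    obtain ⟨ε₁, h₁, hd₁⟩ := ih (fun i => r i.succ) (fun i => e i.succ) _ rfl t
    have hH : (∏ m : Fin n, (X - C (r m.succ)) ^ (e m.succ)).natDegree ≤ ∑ i : Fin n, e i.succ :=
      (natDegree_prod_pow (fun i => r i.succ) (fun i => e i.succ) Finset.univ).le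
    obtain ⟨ε₂, h₂, hd₂⟩ := det_sum (e 0) (∑ i : Fin n, e i.succ)
      (fun a : Fin (e 0) => (X - C (r 0)) ^ (e 0 - (a.1 + 1)))
      (P (fun i => r i.succ) (fun i => e i.succ)) Fin.revPerm t
      (fun a => by have := a.2; simp; omega) (natDegree_P _ _)
      ((X - C (r 0)) ^ e 0) (∏ m : Fin n, (X - C (r m.succ)) ^ (e m.succ))
      (by simp) hH ((split e).trans σ)
    refine ⟨ε₂ * ε₁, ?_, ?_⟩
    · rcases h₁ with rfl | rfl <;> rcases h₂ with rfl | rfl <;> simp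
    rw [← Matrix.det_submatrix_equiv_self (split e)]
    rw [det_pow, resultant_X_sub_C_pow_left _ _ _ _ hH, hd₁] at hd₂
    convert hd₂ using 1
    · congr 1
      ext x y
      rcases x with a | ⟨ℓ, a⟩
      · exact congrArg (fun p : k[X] => p.coeff (σ (split e y))) (P_zero r e a)
      · exact congrArg (fun p : k[X] => p.coeff (σ (split e y))) (P_succ r e ℓ a)
    · rw [Fin.prod_univ_succ, Fin.prod_Ioi_zero]
      simp only [Fin.prod_Ioi_succ, eval_prod, eval_pow, eval_sub, eval_X, eval_C,
        ← Finset.prod_pow, ← pow_mul]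
      simp only [mul_comm (e 0)]
      ring

end SigmaAux



/-- For `f = ∏ (X - rᵢ)^{eᵢ}` with pairwise distinct roots, the determinant of the
coefficient matrix `Σ(f)` equals `±∏_{i<j} (rᵢ - rⱼ)^{eᵢ eⱼ}`. -/
theorem det_sigma_eq_pm_prod (k : Type*) [Field k] (n : ℕ) (r : Fin n → k)
    (hr : Function.Injective r) (e : Fin n → ℕ) (he : ∀ i, 0 < e i)
    (N : ℕ) (hN : N = ∑ i, e i)
    (σ : ((ℓ : Fin n) × Fin (e ℓ)) ≃ Fin N)
    (M : Matrix (Fin N) (Fin N) k)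
    (hM : ∀ (ℓ : Fin n) (j : Fin (e ℓ)) (i : Fin N),
      M (σ ⟨ℓ, j⟩) i =
        ((X - C (r ℓ)) ^ (e ℓ - (j.1 + 1)) *
          ∏ m ∈ Finset.univ.erase ℓ, (X - C (r m)) ^ (e m)).coeff i.1) :
    ∃ ε : k, (ε = 1 ∨ ε = -1) ∧
      M.det = ε * ∏ i : Fin n, ∏ j ∈ Finset.Ioi i, (r i - r j) ^ (e i * e j) := by


  obtain ⟨ε, h, hd⟩ := SigmaAux.main k n r e N hN σ
  refine ⟨ε, h, ?_⟩
  rw [← hd, ← Matrix.det_submatrix_equiv_self σ]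
  congr 1
  ext ⟨ℓ, j⟩ y
  exact hM ℓ j (σ y)
end
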